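/- Let 𝒳, 𝒜, ℬ be finite alphabets, and let P_{A|X} (from 𝒳 to 𝒜) and P_{B|A} (from 𝒜 to ℬ) be stochastic matrices. For t ≥ 0 define F_c(t) as the supremum of H(X|A,U) over all Markov chains U → X → A → B in which U takes values in a finite set, X takes values in 𝒳, the conditional law of A given X is P_{A|X}, the conditional law of B given A is P_{B|A}, and H(X|B,U) ≤ t. Then for every n ≥ 1 and every Markov chain Xⁿ → Aⁿ → Bⁿ in which Xⁿ is an arbitrary 𝒳ⁿ-valued random vector, the conditional law of Aⁿ given Xⁿ is the memoryless channel P_{A|X}^{⊗n}, and the conditional law of Bⁿ given Aⁿ is the memoryless channel P_{B|A}^{⊗n}, it holds that H(Xⁿ|Aⁿ) ≤ n · F_c( (1/n)·H(Xⁿ|Bⁿ) ). -/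

import Mathlib

open scoped BigOperators

noncomputable section

/-- `p` is a probability distribution on the finite set `α`. -/
def IsDist {α : Type*} [Fintype α] (p : α → ℝ) : Prop :=
  (∀ a, 0 ≤ p a) ∧ ∑ a, p a = 1

/-- Shannon entropy `H(p) = −∑ p log p` (natural logarithm). -/
def Hent {α : Type*} [Fintype α] (p : α → ℝ) : ℝ :=
  ∑ a, Real.negMulLog (p a)

/-- Ornstein's `d̄`-distance between distributions on `αⁿ`: `(1/n)` times the minimal expected
Hamming distance over all couplings. -/
def dbar {α : Type*} [Fintype α] [DecidableEq α] (n : ℕ) (p q : (Fin n → α) → ℝ) : ℝ :=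
  sInf { r | ∃ γ : (Fin n → α) × (Fin n → α) → ℝ,
    (∀ z, 0 ≤ γ z) ∧ (∀ x, ∑ y, γ (x, y) = p x) ∧ (∀ y, ∑ x, γ (x, y) = q y) ∧
    r = (1 / (n : ℝ)) * ∑ z : (Fin n → α) × (Fin n → α), γ z * (hammingDist z.1 z.2 : ℝ) }

/-- Conditional Shannon entropy `H(X|Y) = ∑_y P_Y(y) H(P_{X|Y=y})` of the first component
given the second, for a joint distribution `q` on `α × β`. -/
def condEnt {α β : Type*} [Fintype α] [Fintype β] (q : α × β → ℝ) : ℝ :=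
  ∑ y, (∑ x, q (x, y)) * Hent (fun x => q (x, y) / ∑ x', q (x', y))

/-- `F_c(t)`: the supremum of `H(X|A,U)` over all Markov chains `U → X → A → B` with `U` valued
in a finite set (WLOG `Fin m`), where the conditional law of `A` given `X` is `PA`, that of `B`
given `A` is `PB`, and `H(X|B,U) ≤ t`. A Markov chain with these channels is specified exactly
by the joint distribution `p` of `(U, X)`. -/
def Fc {𝒳 𝒜 ℬ : Type*} [Fintype 𝒳] [Fintype 𝒜] [Fintype ℬ]
    (PA : 𝒳 → 𝒜 → ℝ) (PB : 𝒜 → ℬ → ℝ) (t : ℝ) : ℝ :=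
  sSup { r | ∃ (m : ℕ) (p : Fin m × 𝒳 → ℝ), IsDist p ∧
    condEnt (fun z : 𝒳 × (ℬ × Fin m) =>
      p (z.2.2, z.1) * ∑ a, PA z.1 a * PB a z.2.1) ≤ t ∧
    r = condEnt (fun z : 𝒳 × (𝒜 × Fin m) => p (z.2.2, z.1) * PA z.1 z.2.1) }

/-! ### Unnormalised entropy functional -/

/-- Unnormalised entropy of a finite nonnegative vector. -/
def Gf {α : Type*} [Fintype α] (v : α → ℝ) : ℝ :=
  (∑ x, v x) * Hent (fun x => v x / ∑ x', v x')

/-- Conditional entropy of the input given output and side information. -/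
def Dcond {X C U : Type*} [Fintype X] [Fintype C] [Fintype U]
    (W : X → C → ℝ) (p : U → X → ℝ) : ℝ :=
  ∑ u, ∑ c, Gf (fun x => p u x * W x c)

theorem Gf_smul {α : Type*} [Fintype α] (k : ℝ) (v : α → ℝ) :
    Gf (fun x => k * v x) = k * Gf v := by
  unfold Gf
  by_cases hk : k = 0
  · simp [hk]
  · rw [← Finset.mul_sum]
    simp only [mul_div_mul_left _ _ hk]
    ring

theorem Gf_reindex {α β : Type*} [Fintype α] [Fintype β] (e : α ≃ β) (v : β → ℝ) :
    Gf v = Gf (fun x => v (e x)) := by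
  unfold Gf Hent
  rw [e.sum_comp v, ← e.sum_comp (fun a => Real.negMulLog (v a / _))]

theorem Gf_formula {α : Type*} [Fintype α] (v : α → ℝ) (hv : ∀ x, 0 ≤ v x) :
    Gf v = ∑ x, Real.negMulLog (v x) - Real.negMulLog (∑ x, v x) := by
  unfold Gf Hent
  by_cases hS : ∑ x, v x = 0
  · have h0 : ∀ x, v x = 0 := by
      intro x
      exact (Finset.sum_eq_zero_iff_of_nonneg (fun i _ => hv i)).1 hS x (Finset.mem_univ x)
    simp [h0]
  · have key : ∀ x, (∑ x, v x) * Real.negMulLog (v x / ∑ x', v x')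
        = Real.negMulLog (v x) + v x * Real.log (∑ x, v x) := by
      intro x
      by_cases hx : v x = 0
      · simp [hx]
      · unfold Real.negMulLog
        rw [Real.log_div hx hS]
        field_simp
        ring
    rw [Finset.mul_sum, Finset.sum_congr rfl (fun x _ => key x), Finset.sum_add_distrib,
      ← Finset.sum_mul]
    unfold Real.negMulLog
    ring

theorem Gf_chain {α β : Type*} [Fintype α] [Fintype β] (v : α × β → ℝ) (hv : ∀ x, 0 ≤ v x) :
    Gf v = Gf (fun x => ∑ y, v (x, y)) + ∑ x, Gf (fun y => v (x, y)) := by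
  rw [Gf_formula v hv, Gf_formula _ (fun x => Finset.sum_nonneg (fun y _ => hv (x, y)))]
  rw [Finset.sum_congr rfl (fun x _ => Gf_formula (fun y => v (x, y)) (fun y => hv (x, y)))]
  rw [Finset.sum_sub_distrib, Fintype.sum_prod_type, Fintype.sum_prod_type]
  ring

theorem Gf_superadd {α ι : Type*} [Fintype α] [Fintype ι] (v : ι → α → ℝ)
    (hv : ∀ i x, 0 ≤ v i x) :
    ∑ i, Gf (v i) ≤ Gf (fun x => ∑ i, v i x) := by
  unfold Gf Hent
  have hcomm : ∑ x, ∑ i, v i x = ∑ i, ∑ x, v i x := Finset.sum_comm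
  rw [hcomm]
  set s : ι → ℝ := fun i => ∑ x, v i x with hs
  have hs0 : ∀ i, 0 ≤ s i := fun i => Finset.sum_nonneg (fun x _ => hv i x)
  have hz : ∀ i x, s i = 0 → v i x = 0 := fun i x h =>
    (Finset.sum_eq_zero_iff_of_nonneg (fun j _ => hv i j)).1 h x (Finset.mem_univ x)
  simp only [Finset.mul_sum]
  rw [Finset.sum_comm]
  apply Finset.sum_le_sum
  intro x _
  by_cases hS : ∑ i, s i = 0
  · have h0 : ∀ i, s i = 0 := fun i =>
      (Finset.sum_eq_zero_iff_of_nonneg (fun j _ => hs0 j)).1 hS i (Finset.mem_univ i)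
    have h1 : ∀ i, ∑ x, v i x = 0 := h0
    rw [hS]
    simp [h1]
  · have hSpos : 0 < ∑ i, s i := lt_of_le_of_ne (Finset.sum_nonneg (fun i _ => hs0 i)) (Ne.symm hS)
    have := Real.concaveOn_negMulLog.le_map_sum (t := Finset.univ)
      (w := fun i => s i / ∑ j, s j) (p := fun i => v i x / s i)
      (fun i _ => div_nonneg (hs0 i) hSpos.le)
      (by rw [← Finset.sum_div, div_self hS])
      (fun i _ => div_nonneg (hv i x) (hs0 i))
    simp only [smul_eq_mul] at this
    have e1 : ∑ i, s i / (∑ j, s j) * (v i x / s i) = (∑ i, v i x) / ∑ j, s j := by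
      rw [Finset.sum_div]
      refine Finset.sum_congr rfl (fun i _ => ?_)
      by_cases hi : s i = 0
      · simp [hi, hz i x hi]
      · field_simp
    rw [e1] at this
    have h2 := mul_le_mul_of_nonneg_left this hSpos.le
    refine le_trans (le_of_eq ?_) h2
    rw [Finset.mul_sum]
    refine Finset.sum_congr rfl (fun i _ => ?_)
    change s i * Real.negMulLog (v i x / s i) = _
    field_simp

theorem Gf_le {α : Type*} [Fintype α] (v : α → ℝ) (hv : ∀ x, 0 ≤ v x) :
    Gf v ≤ (∑ x, v x) * Fintype.card α := by
  unfold Gf Hent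
  have hS : 0 ≤ ∑ x, v x := Finset.sum_nonneg (fun x _ => hv x)
  refine mul_le_mul_of_nonneg_left ?_ hS
  calc _ ≤ ∑ x : α, (1 : ℝ) := by
        refine Finset.sum_le_sum (fun x _ => ?_)
        beta_reduce
        have h0 : 0 ≤ v x / ∑ x', v x' := div_nonneg (hv x) hS
        rcases h0.eq_or_lt with h | h
        · rw [← h]; simp
        · have h1 := Real.one_sub_inv_le_log_of_pos h
          have h2 := mul_le_mul_of_nonneg_left h1 h0
          unfold Real.negMulLog
          rw [mul_sub, mul_inv_cancel₀ h.ne'] at h2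
          linarith
    _ = _ := by simp

theorem Dcond_smul {X C U : Type*} [Fintype X] [Fintype C] [Fintype U]
    (W : X → C → ℝ) (k : ℝ) (p : U → X → ℝ) :
    Dcond W (fun u x => k * p u x) = k * Dcond W p := by
  unfold Dcond
  simp only [mul_assoc, Gf_smul, Finset.mul_sum]

theorem Dcond_reindex {X C X' C' U : Type*} [Fintype X] [Fintype C] [Fintype X'] [Fintype C']
    [Fintype U] (eX : X' ≃ X) (eC : C' ≃ C) (W : X → C → ℝ) (p : U → X → ℝ) :
    Dcond W p = Dcond (fun x c => W (eX x) (eC c)) (fun u x => p u (eX x)) := by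
  unfold Dcond
  refine Finset.sum_congr rfl (fun u _ => ?_)
  rw [← eC.sum_comp]
  exact Finset.sum_congr rfl (fun c _ => Gf_reindex eX _)

theorem Dcond_reindexU {X C U U' : Type*} [Fintype X] [Fintype C] [Fintype U] [Fintype U']
    (e : U' ≃ U) (W : X → C → ℝ) (p : U → X → ℝ) :
    Dcond W p = Dcond W (fun u x => p (e u) x) := by
  unfold Dcond
  rw [← e.sum_comp]

theorem Dcond_sum {X C U U' : Type*} [Fintype X] [Fintype C] [Fintype U] [Fintype U']
    (W : X → C → ℝ) (p : U → X → ℝ) (p' : U' → X → ℝ) :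
    Dcond W (Sum.elim p p') = Dcond W p + Dcond W p' := by
  unfold Dcond
  rw [Fintype.sum_sum_type]
  rfl

theorem Dcond_step {X C X' C' U : Type*} [Fintype X] [Fintype C] [Fintype X'] [Fintype C']
    [Fintype U] (W : X → C → ℝ) (W' : X' → C' → ℝ)
    (hW : ∀ x, (∀ a, 0 ≤ W x a) ∧ ∑ a, W x a = 1) (hW' : ∀ x a, 0 ≤ W' x a)
    (q : U → X × X' → ℝ) (hq : ∀ u x, 0 ≤ q u x) :
    Dcond (fun (z : X × X') (c : C × C') => W z.1 c.1 * W' z.2 c.2) q =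
      Dcond W (fun (u : C' × U) x => ∑ x', q u.2 (x, x') * W' x' u.1) +
      Dcond W' (fun (u : X × U) x' => q u.2 (u.1, x')) := by
  unfold Dcond
  rw [Fintype.sum_prod_type_right, Fintype.sum_prod_type_right, ← Finset.sum_add_distrib]
  refine Finset.sum_congr rfl (fun u _ => ?_)
  rw [Fintype.sum_prod_type_right]
  have h : ∀ c' c, Gf (fun x : X × X' => q u x * (W x.1 c * W' x.2 c')) =
      Gf (fun x => (∑ x', q u (x, x') * W' x' c') * W x c) +
      ∑ x, W x c * Gf (fun x' => q u (x, x') * W' x' c') := by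
    intro c' c
    rw [Gf_chain _ (fun x => mul_nonneg (hq u x) (mul_nonneg ((hW _).1 _) (hW' _ _)))]
    congr 1
    · congr 1
      funext x
      rw [Finset.sum_mul]
      exact Finset.sum_congr rfl (fun _ _ => by ring)
    · refine Finset.sum_congr rfl (fun x _ => ?_)
      rw [← Gf_smul]
      congr 1
      funext x'
      ring
  simp only [h, Finset.sum_add_distrib]
  congr 1
  rw [Finset.sum_comm (s := (Finset.univ : Finset X))]
  refine Finset.sum_congr rfl (fun c' _ => ?_)
  rw [Finset.sum_comm]
  refine Finset.sum_congr rfl (fun x _ => ?_)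
  rw [← Finset.sum_mul, (hW x).2, one_mul]

/-- Data processing for the side information. -/
theorem Dcond_dpi {X C S T U : Type*} [Fintype X] [Fintype C] [Fintype S] [Fintype T] [Fintype U]
    (W : X → C → ℝ) (hW : ∀ x a, 0 ≤ W x a) (K : S → T → ℝ)
    (hK : ∀ x, (∀ a, 0 ≤ K x a) ∧ ∑ a, K x a = 1)
    (p : S × U → X → ℝ) (hp : ∀ u x, 0 ≤ p u x) :
    Dcond W p ≤ Dcond W (fun (u : T × U) x => ∑ s, p (s, u.2) x * K s u.1) := by
  unfold Dcond
  rw [Fintype.sum_prod_type_right, Fintype.sum_prod_type_right]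
  refine Finset.sum_le_sum (fun u _ => ?_)
  have h : ∀ t c, ∑ s, K s t * Gf (fun x => p (s, u) x * W x c) ≤
      Gf (fun x => (∑ s, p (s, u) x * K s t) * W x c) := by
    intro t c
    have := Gf_superadd (fun (s : S) (x : X) => K s t * (p (s, u) x * W x c))
      (fun s x => mul_nonneg ((hK s).1 t) (mul_nonneg (hp _ _) (hW _ _)))
    simp only [Gf_smul] at this
    refine this.trans (le_of_eq ?_)
    congr 1
    funext x
    rw [Finset.sum_mul]
    exact Finset.sum_congr rfl (fun _ _ => by ring)
  refine le_trans (le_of_eq ?_)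
    (Finset.sum_le_sum (fun t _ => Finset.sum_le_sum (fun c _ => h t c)))
  rw [Finset.sum_comm]
  rw [Finset.sum_comm (s := (Finset.univ : Finset T))]
  refine Finset.sum_congr rfl (fun c _ => ?_)
  rw [Finset.sum_comm]
  refine Finset.sum_congr rfl (fun s _ => ?_)
  rw [← Finset.sum_mul, (hK s).2, one_mul]

theorem prod_stoch {X A : Type*} [Fintype A] (PA : X → A → ℝ)
    (hPA : ∀ x, (∀ a, 0 ≤ PA x a) ∧ ∑ a, PA x a = 1) (n : ℕ) (x : Fin n → X) :
    (∀ a : Fin n → A, 0 ≤ ∏ i, PA (x i) (a i)) ∧ ∑ a : Fin n → A, ∏ i, PA (x i) (a i) = 1 := by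
  classical
  refine ⟨fun a => Finset.prod_nonneg (fun i _ => (hPA _).1 _), ?_⟩
  have := Finset.prod_univ_sum (fun _ : Fin n => (Finset.univ : Finset A)) (fun i a => PA (x i) a)
  rw [Fintype.piFinset_univ] at this
  rw [← this]
  simp [(hPA _).2]

theorem prod_comp {X A B : Type*} [Fintype A] (PA : X → A → ℝ) (PB : A → B → ℝ)
    (n : ℕ) (x : Fin n → X) (b : Fin n → B) :
    ∑ a : Fin n → A, (∏ i, PA (x i) (a i)) * ∏ i, PB (a i) (b i) =
      ∏ i, ∑ a, PA (x i) a * PB a (b i) := by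
  classical
  rw [Finset.prod_univ_sum, Fintype.piFinset_univ]
  simp only [Finset.prod_mul_distrib]

theorem stoch_comp {X A B : Type*} [Fintype A] [Fintype B] (PA : X → A → ℝ) (PB : A → B → ℝ)
    (hPA : ∀ x, (∀ a, 0 ≤ PA x a) ∧ ∑ a, PA x a = 1)
    (hPB : ∀ a, (∀ b, 0 ≤ PB a b) ∧ ∑ b, PB a b = 1) (x : X) :
    (∀ b, 0 ≤ ∑ a, PA x a * PB a b) ∧ ∑ b, ∑ a, PA x a * PB a b = 1 := by
  refine ⟨fun b => Finset.sum_nonneg (fun a _ => mul_nonneg ((hPA x).1 a) ((hPB a).1 b)), ?_⟩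
  rw [Finset.sum_comm]
  simp only [← Finset.mul_sum, (hPB _).2, mul_one, (hPA x).2]

theorem Dcond_succ {X C U : Type*} [Fintype X] [Fintype C] [Fintype U] (W : X → C → ℝ) (n : ℕ)
    (q : U → (Fin (n + 1) → X) → ℝ) :
    Dcond (fun (x : Fin (n + 1) → X) (c : Fin (n + 1) → C) => ∏ i, W (x i) (c i)) q =
    Dcond (fun (z : X × (Fin n → X)) (c : C × (Fin n → C)) =>
      W z.1 c.1 * ∏ i, W (z.2 i) (c.2 i)) (fun u z => q u (Fin.cons z.1 z.2)) := by
  rw [Dcond_reindex (Fin.consEquiv (fun _ => X)) (Fin.consEquiv (fun _ => C))]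
  simp [Fin.consEquiv, Fin.prod_univ_succ]

theorem main_ind.{u, v, w} {X : Type u} {A : Type v} {B : Type w} [Fintype X] [Fintype A]
    [Fintype B] (PA : X → A → ℝ) (PB : A → B → ℝ)
    (hPA : ∀ x, (∀ a, 0 ≤ PA x a) ∧ ∑ a, PA x a = 1)
    (hPB : ∀ a, (∀ b, 0 ≤ PB a b) ∧ ∑ b, PB a b = 1) (n : ℕ) :
    ∀ (V : Type u) [Fintype V] (q : V → (Fin n → X) → ℝ) (_ : ∀ u x, 0 ≤ q u x),
    ∃ (m : ℕ) (p : Fin m → X → ℝ), (∀ u x, 0 ≤ p u x) ∧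
      (∑ u, ∑ x, p u x = n * ∑ u, ∑ x, q u x) ∧
      Dcond (fun x b => ∑ a, PA x a * PB a b) p =
        Dcond (fun (x : Fin n → X) (c : Fin n → B) => ∏ i, ∑ a, PA (x i) a * PB a (c i)) q ∧
      Dcond (fun (x : Fin n → X) (c : Fin n → A) => ∏ i, PA (x i) (c i)) q ≤ Dcond PA p := by
  induction n with
  | zero =>
    intro V _ q hq
    have hz0 : ∀ t : ℝ, t = 0 ∨ (t / t).negMulLog = 0 := by
      intro t
      by_cases h : t = 0
      · exact Or.inl h
      · exact Or.inr (by simp [h])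
    have hz0 : ∀ t : ℝ, t * (t / t).negMulLog = 0 := fun t => mul_eq_zero.2 (hz0 t)
    refine ⟨0, fun _ _ => 0, fun _ _ => le_rfl, by simp, ?_, ?_⟩
    · simp [Dcond, Gf, Hent, hz0]
    · simp [Dcond, Gf, Hent, hz0]
  | succ n ih =>
    intro V _ q hq
    obtain ⟨m, p, hp0, hps, hpB, hpA⟩ := ih (X × V) (fun u x' => q u.2 (Fin.cons u.1 x'))
      (fun u x => hq _ _)
    set Q : X → B → ℝ := fun x b => ∑ a, PA x a * PB a b with hQ
    have hQs : ∀ x, (∀ b, 0 ≤ Q x b) ∧ ∑ b, Q x b = 1 := stoch_comp PA PB hPA hPB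
    have hQn := prod_stoch Q hQs n
    let p1 : (Fin n → B) × V → X → ℝ := fun u x =>
      ∑ x' : Fin n → X, q u.2 (Fin.cons x x') * ∏ i, Q (x' i) (u.1 i)
    have hp1 : ∀ u x, 0 ≤ p1 u x := fun u x =>
      Finset.sum_nonneg (fun x' _ => mul_nonneg (hq _ _) ((hQn x').1 _))
    let e := (Fintype.equivFin (((Fin n → B) × V) ⊕ Fin m)).symm
    refine ⟨_, fun u x => Sum.elim p1 p (e u) x, ?_, ?_, ?_, ?_⟩
    · intro u x
      beta_reduce
      rcases e u with u | u
      · exact hp1 u x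
      · exact hp0 u x
    · rw [e.sum_comp (fun u => ∑ x, Sum.elim p1 p u x), Fintype.sum_sum_type]
      simp only [Sum.elim_inl, Sum.elim_inr]
      rw [hps]
      have hmass : ∀ u, ∑ x, q u x = ∑ x : X, ∑ x' : Fin n → X, q u (Fin.cons x x') := by
        intro u
        rw [← (Fin.consEquiv (fun _ => X)).sum_comp, Fintype.sum_prod_type]
        rfl
      have h2 : ∑ u : X × V, ∑ x' : Fin n → X, q u.2 (Fin.cons u.1 x') = ∑ u, ∑ x, q u x := by
        rw [Fintype.sum_prod_type_right]
        exact Finset.sum_congr rfl (fun u _ => (hmass u).symm)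
      have h1 : ∑ u, ∑ x, p1 u x = ∑ u, ∑ x, q u x := by
        rw [Fintype.sum_prod_type_right]
        refine Finset.sum_congr rfl (fun u _ => ?_)
        rw [hmass u, Finset.sum_comm]
        refine Finset.sum_congr rfl (fun x _ => ?_)
        simp only [p1]
        rw [Finset.sum_comm]
        refine Finset.sum_congr rfl (fun x' _ => ?_)
        rw [← Finset.mul_sum, (hQn x').2, mul_one]
      rw [h1, h2]
      push_cast
      ring
    · rw [← Dcond_reindexU e, Dcond_sum, hpB]
      have := Dcond_succ Q n q
      simp only [hQ] at this ⊢
      rw [this, Dcond_step _ (fun x' c' => ∏ i, Q (x' i) (c' i)) hQs (fun x a => (hQn x).1 a) _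
        (fun u x => hq _ _)]
    · rw [← Dcond_reindexU e, Dcond_sum, Dcond_succ PA n q,
        Dcond_step _ (fun x' c' => ∏ i, PA (x' i) (c' i)) hPA
          (fun x a => (prod_stoch PA hPA n x).1 a) _ (fun u x => hq _ _)]
      refine add_le_add ?_ hpA
      refine (Dcond_dpi PA (fun x a => (hPA x).1 a)
        (fun (a : Fin n → A) (b : Fin n → B) => ∏ i, PB (a i) (b i)) (prod_stoch PB hPB n) _
        (fun u x => Finset.sum_nonneg (fun x' _ =>
          mul_nonneg (hq _ _) ((prod_stoch PA hPA n x').1 _)))).trans (le_of_eq ?_)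
      congr 1
      funext u x
      simp only [p1, hQ, ← prod_comp, Finset.mul_sum, Finset.sum_mul]
      rw [Finset.sum_comm]
      simp only [mul_assoc]

theorem condEnt_eq_Dcond {X C U : Type*} [Fintype X] [Fintype C] [Fintype U]
    (W : X → C → ℝ) (p : U × X → ℝ) :
    condEnt (fun z : X × (C × U) => p (z.2.2, z.1) * W z.1 z.2.1) =
      Dcond W (fun u x => p (u, x)) := by
  unfold condEnt Dcond Gf
  rw [Fintype.sum_prod_type_right]

theorem condEnt_eq_Dcond' {X C : Type*} [Fintype X] [Fintype C]
    (W : X → C → ℝ) (p : X → ℝ) :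
    condEnt (fun z : X × C => p z.1 * W z.1 z.2) =
      Dcond W (fun (_ : PUnit) x => p x) := by
  unfold condEnt Dcond Gf
  simp

theorem Dcond_le {X C U : Type*} [Fintype X] [Fintype C] [Fintype U]
    (W : X → C → ℝ) (hW : ∀ x, (∀ a, 0 ≤ W x a) ∧ ∑ a, W x a = 1)
    (p : U → X → ℝ) (hp : ∀ u x, 0 ≤ p u x) :
    Dcond W p ≤ (∑ u, ∑ x, p u x) * Fintype.card X := by
  unfold Dcond
  rw [Finset.sum_mul]
  refine Finset.sum_le_sum (fun u _ => ?_)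
  refine (Finset.sum_le_sum (fun c _ =>
    Gf_le _ (fun x => mul_nonneg (hp u x) ((hW x).1 c)))).trans (le_of_eq ?_)
  rw [← Finset.sum_mul, Finset.sum_comm]
  simp only [← Finset.mul_sum, (hW _).2, mul_one]

/-- (Tensorization of `F_c`) For every `n ≥ 1` and every Markov chain
`Xⁿ → Aⁿ → Bⁿ` where `Xⁿ ∼ pX` is arbitrary, `Aⁿ` is the output of the memoryless channel
`PA^{⊗n}` on `Xⁿ`, and `Bⁿ` is the output of the memoryless channel `PB^{⊗n}` on `Aⁿ`,
`H(Xⁿ|Aⁿ) ≤ n F_c((1/n) H(Xⁿ|Bⁿ))`. -/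
theorem stmt19 {𝒳 𝒜 ℬ : Type*} [Fintype 𝒳] [Fintype 𝒜] [Fintype ℬ]
    (PA : 𝒳 → 𝒜 → ℝ) (PB : 𝒜 → ℬ → ℝ)
    (hPA : ∀ x, (∀ a, 0 ≤ PA x a) ∧ ∑ a, PA x a = 1)
    (hPB : ∀ a, (∀ b, 0 ≤ PB a b) ∧ ∑ b, PB a b = 1)
    {n : ℕ} (hn : 1 ≤ n)
    (pX : (Fin n → 𝒳) → ℝ) (hpX : IsDist pX) :
    condEnt (fun z : (Fin n → 𝒳) × (Fin n → 𝒜) => pX z.1 * ∏ i, PA (z.1 i) (z.2 i)) ≤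
      n * Fc PA PB ((1 / (n : ℝ)) *
        condEnt (fun z : (Fin n → 𝒳) × (Fin n → ℬ) =>
          pX z.1 * ∑ a : Fin n → 𝒜, (∏ i, PA (z.1 i) (a i)) * ∏ i, PB (a i) (z.2 i))) := by
  have hn0 : (n : ℝ) ≠ 0 := by positivity
  have hnpos : (0 : ℝ) < n := by positivity
  obtain ⟨m, p, hp0, hps, hpB, hpA⟩ := main_ind PA PB hPA hPB n PUnit (fun _ x => pX x)
    (fun _ x => hpX.1 x)
  have hsum : ∑ u, ∑ x, p u x = n := by
    rw [hps]
    simp [hpX.2]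
  rw [condEnt_eq_Dcond' (fun (x : Fin n → 𝒳) (a : Fin n → 𝒜) => ∏ i, PA (x i) (a i)) pX]
  rw [condEnt_eq_Dcond' (fun (x : Fin n → 𝒳) (b : Fin n → ℬ) =>
    ∑ a : Fin n → 𝒜, (∏ i, PA (x i) (a i)) * ∏ i, PB (a i) (b i)) pX]
  simp only [prod_comp]
  rw [← hpB]
  refine hpA.trans ?_
  have hle : (1 / (n : ℝ)) * Dcond PA p ≤
      Fc PA PB ((1 / (n : ℝ)) * Dcond (fun x b => ∑ a, PA x a * PB a b) p) := by
    unfold Fc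
    apply le_csSup
    · refine ⟨Fintype.card 𝒳, ?_⟩
      rintro r ⟨m', p', hp', -, rfl⟩
      rw [condEnt_eq_Dcond PA p']
      refine (Dcond_le PA hPA _ (fun u x => hp'.1 _)).trans (le_of_eq ?_)
      have := hp'.2
      rw [Fintype.sum_prod_type] at this
      rw [this, one_mul]
    · refine ⟨m, fun z => (1 / (n : ℝ)) * p z.1 z.2, ⟨?_, ?_⟩, ?_, ?_⟩
      · intro z
        exact mul_nonneg (by positivity) (hp0 _ _)
      · rw [Fintype.sum_prod_type]
        simp only [← Finset.mul_sum]
        rw [hsum]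
        field_simp
      · rw [condEnt_eq_Dcond (fun x b => ∑ a, PA x a * PB a b)
          (fun z : Fin m × 𝒳 => (1 / (n : ℝ)) * p z.1 z.2), Dcond_smul]
      · rw [condEnt_eq_Dcond PA (fun z : Fin m × 𝒳 => (1 / (n : ℝ)) * p z.1 z.2), Dcond_smul]
  calc Dcond PA p = n * ((1 / (n : ℝ)) * Dcond PA p) := by field_simp
    _ ≤ _ := mul_le_mul_of_nonneg_left hle hnpos.le
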